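/- arXiv:2305.07730 — 6 statements merged into one kernel-verified Lean document; each statement's English description precedes it below -/
import Mathlib

section
/- Let E be a real inner product space, let θ ∈ E with ‖θ‖ = 1, let w ∈ E with w ≠ 0, and define the projection p := θ − (⟪θ, w⟫/‖w‖²) • w. Assume p ≠ 0. Then p/‖p‖ minimizes ‖θ − θ̃‖ over the set {θ̃ ∈ E : ⟪θ̃, w⟫ = 0 and ‖θ̃‖ = 1}; that is, for every θ̃ ∈ E with ⟪θ̃, w⟫ = 0 and ‖θ̃‖ = 1, we have ‖θ − p/‖p‖‖ ≤ ‖θ − θ̃‖. -/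
open RealInnerProductSpace

theorem normalized_projection_minimizes_dist {E : Type*} [NormedAddCommGroup E]
    [InnerProductSpace ℝ E] (θ w : E) (hθ : ‖θ‖ = 1) (hw : w ≠ 0)
    (p : E) (hp : p = θ - (⟪θ, w⟫ / ‖w‖ ^ 2) • w) (hp0 : p ≠ 0) :
    ∀ θt : E, ⟪θt, w⟫ = 0 → ‖θt‖ = 1 → ‖θ - ‖p‖⁻¹ • p‖ ≤ ‖θ - θt‖ := by
  intro t ht ht1
  have hwn : ‖w‖ ≠ 0 := norm_ne_zero_iff.mpr hw
  have hpn : ‖p‖ ≠ 0 := norm_ne_zero_iff.mpr hp0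
  have key : ∀ v : E, ⟪v, w⟫ = 0 → ⟪θ, v⟫ = ⟪p, v⟫ := by
    intro v hv
    rw [hp, inner_sub_left, real_inner_smul_left, real_inner_comm v w, hv]
    ring
  have hpw : ⟪p, w⟫ = 0 := by
    rw [hp, inner_sub_left, real_inner_smul_left, real_inner_self_eq_norm_sq]
    field_simp
    ring
  have h1 : ⟪θ, t⟫ ≤ ‖p‖ := by
    rw [key t ht]
    simpa [ht1] using real_inner_le_norm p t
  have h2 : ⟪θ, ‖p‖⁻¹ • p⟫ = ‖p‖ := by
    rw [real_inner_smul_right, key p hpw, real_inner_self_eq_norm_sq]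
    field_simp
  have h3 : ‖‖p‖⁻¹ • p‖ = 1 := by
    rw [norm_smul, norm_inv, norm_norm, inv_mul_cancel₀ hpn]
  refine (sq_le_sq₀ (norm_nonneg _) (norm_nonneg _)).mp ?_
  rw [norm_sub_sq_real, norm_sub_sq_real, h2, h3, ht1]
  linarith
end

section
/- Let a₁, …, a_m (m ≥ 1) be nonzero vectors in a real inner product space E, and suppose there exists θ₀ ∈ E with ⟪θ₀, a_j⟫ > 0 for all j (nonempty interior of the consistent cone). Suppose θ̄ ∈ E minimizes ‖θ‖ over the set {θ ∈ E : ⟪θ, a_j⟫ ≥ ‖a_j‖ for all j ∈ [m]}. Then θ̄ ≠ 0, the pair (θ̄/‖θ̄‖, 1/‖θ̄‖) is feasible for the incenter problem, i.e., ‖θ̄/‖θ̄‖‖ = 1 and ⟪θ̄/‖θ̄‖, a_j⟫ ≥ (1/‖θ̄‖)·‖a_j‖ for all j, and it is optimal: for every pair (θ, r) with ‖θ‖ = 1 and ⟪θ, a_j⟫ ≥ r‖a_j‖ for all j, we have r ≤ 1/‖θ̄‖. -/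
open RealInnerProductSpace

theorem incenter_convex_characterization {E : Type*} [NormedAddCommGroup E]
    [InnerProductSpace ℝ E] (m : ℕ) (hm : 1 ≤ m) (a : Fin m → E)
    (ha : ∀ j, a j ≠ 0) (θ₀ : E) (hθ₀ : ∀ j, 0 < ⟪θ₀, a j⟫)
    (θbar : E) (hfeas : ∀ j, ⟪θbar, a j⟫ ≥ ‖a j‖)
    (hopt : ∀ θ : E, (∀ j, ⟪θ, a j⟫ ≥ ‖a j‖) → ‖θbar‖ ≤ ‖θ‖) :
    θbar ≠ 0 ∧ ‖(‖θbar‖⁻¹ • θbar)‖ = 1 ∧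
      (∀ j, ⟪‖θbar‖⁻¹ • θbar, a j⟫ ≥ ‖θbar‖⁻¹ * ‖a j‖) ∧
      ∀ (θ : E) (r : ℝ), ‖θ‖ = 1 → (∀ j, ⟪θ, a j⟫ ≥ r * ‖a j‖) → r ≤ ‖θbar‖⁻¹ := by
  have hne : θbar ≠ 0 := by
    intro h
    have h1 := hfeas ⟨0, hm⟩
    rw [h, inner_zero_left] at h1
    exact absurd (norm_pos_iff.mpr (ha ⟨0, hm⟩)) (not_lt.mpr h1)
  have hpos : 0 < ‖θbar‖ := norm_pos_iff.mpr hne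
  refine ⟨hne, ?_, ?_, ?_⟩
  · rw [norm_smul, norm_inv, norm_norm, inv_mul_cancel₀ hpos.ne']
  · intro j
    rw [real_inner_smul_left]
    exact mul_le_mul_of_nonneg_left (hfeas j) (inv_nonneg.mpr hpos.le)
  · intro θ r hθ hr
    rcases le_or_gt r 0 with h0 | h0
    · exact h0.trans (inv_nonneg.mpr hpos.le)
    · have h1 : ‖θbar‖ ≤ ‖r⁻¹ • θ‖ := by
        apply hopt
        intro j
        rw [real_inner_smul_left]
        have h2 := mul_le_mul_of_nonneg_left (hr j) (inv_nonneg.mpr h0.le)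
        rwa [inv_mul_cancel_left₀ h0.ne'] at h2
      rw [norm_smul, hθ, mul_one, norm_inv, Real.norm_of_nonneg h0.le] at h1
      exact (le_inv_comm₀ hpos h0).mp h1
end

section
/- Let E be a real inner product space, α a type, S a nonempty finite set of elements of α (the feasible set), φ : α → E a feature map, d : α → α → ℝ a distance function with d x y ≥ 0 for all x, y, and x̂ ∈ S a fixed expert response. Define the Augmented Suboptimality Loss ℓ(θ) := max_{x ∈ S} (⟪θ, φ x̂ − φ x⟫ + d x̂ x) and the Generalized Predictability Loss ℓ^pred(θ) := min { d x̂ y : y ∈ S and y minimizes x ↦ ⟪θ, φ x⟫ over S }. Then ℓ^pred(θ) ≤ ℓ(θ) for every θ ∈ E; that is, the Augmented Suboptimality Loss is a convex upper bound (convex surrogate) of the Generalized Predictability Loss. -/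
open RealInnerProductSpace

open Classical in
theorem ASL_convex_surrogate_of_GPL {E : Type*} [NormedAddCommGroup E]
    [InnerProductSpace ℝ E] {α : Type*} (S : Finset α) (hS : S.Nonempty)
    (φ : α → E) (d : α → α → ℝ) (hd : ∀ x y, 0 ≤ d x y)
    (xhat : α) (hx : xhat ∈ S) (θ : E)
    (hM : (S.filter fun y => ∀ x ∈ S, ⟪θ, φ y⟫ ≤ ⟪θ, φ x⟫).Nonempty) :
    (S.filter fun y => ∀ x ∈ S, ⟪θ, φ y⟫ ≤ ⟪θ, φ x⟫).inf' hM (fun y => d xhat y) ≤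
      S.sup' hS (fun x => ⟪θ, φ xhat - φ x⟫ + d xhat x) := by
  obtain ⟨y, hy⟩ := hM
  have hy' := Finset.mem_filter.mp hy
  have h1 := hy'.2 xhat hx
  refine (Finset.inf'_le (fun y => d xhat y) hy).trans ?_
  refine le_trans ?_ (Finset.le_sup' (fun x => ⟪θ, φ xhat - φ x⟫ + d xhat x) hy'.1)
  simp only [inner_sub_right]
  linarith
end

section
/- Let E be a real inner product space, α a type, S a nonempty finite set of elements of α (the feasible set), φ : α → E a feature map, d : α → α → ℝ a distance function, and x̂ ∈ α a fixed expert response. Define ℓ(θ) := max_{x ∈ S} (⟪θ, φ x̂ − φ x⟫ + d x̂ x). Let ε ≥ 0 and let x_ε ∈ S be an ε-suboptimal solution of the inner maximization, i.e., d x̂ x_ε − ⟪θ, φ x_ε⟫ ≥ max_{x ∈ S} (d x̂ x − ⟪θ, φ x⟫) − ε. Then the vector g_ε := φ x̂ − φ x_ε is an ε-subgradient of ℓ at θ: for every ν ∈ E, ℓ(θ) − ℓ(ν) ≤ ⟪φ x̂ − φ x_ε, θ − ν⟫ + ε. -/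
open RealInnerProductSpace

theorem approximate_solution_eps_subgradient {E : Type*} [NormedAddCommGroup E]
    [InnerProductSpace ℝ E] {α : Type*} (S : Finset α) (hS : S.Nonempty)
    (φ : α → E) (d : α → α → ℝ) (xhat : α) (θ : E) (ε : ℝ) (hε : 0 ≤ ε)
    (xeps : α) (hxeps : xeps ∈ S)
    (happrox : d xhat xeps - ⟪θ, φ xeps⟫ ≥
      S.sup' hS (fun x => d xhat x - ⟪θ, φ x⟫) - ε) :
    ∀ ν : E,
      S.sup' hS (fun x => ⟪θ, φ xhat - φ x⟫ + d xhat x) -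
        S.sup' hS (fun x => ⟪ν, φ xhat - φ x⟫ + d xhat x) ≤
      ⟪φ xhat - φ xeps, θ - ν⟫ + ε := by
  intro ν
  have h1 : S.sup' hS (fun x => ⟪θ, φ xhat - φ x⟫ + d xhat x) ≤
      ⟪θ, φ xhat - φ xeps⟫ + d xhat xeps + ε := by
    apply Finset.sup'_le
    intro x hx
    have h := Finset.le_sup' (fun x => d xhat x - ⟪θ, φ x⟫) hx
    simp only [inner_sub_right] at h ⊢
    linarith
  have h2 := Finset.le_sup' (fun x => ⟪ν, φ xhat - φ x⟫ + d xhat x) hxeps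
  have h3 : ⟪φ xhat - φ xeps, θ - ν⟫ =
      ⟪θ, φ xhat - φ xeps⟫ - ⟪ν, φ xhat - φ xeps⟫ := by
    rw [real_inner_comm, inner_sub_left]
  linarith
end

section
/- Let E be a real inner product space, Θ ⊆ E a nonempty convex set, and f : E → ℝ convex on Θ with a minimizer θ* ∈ Θ (f(θ*) ≤ f(ν) for all ν ∈ Θ). Let T ≥ 1, let c > 0, G ≥ 0, R ≥ 0, and for t = 1, …, T set η_t = c/√t. Let θ₁, …, θ_{T+1} ∈ Θ, g₁, …, g_T ∈ E, and ε₁, …, ε_T ≥ 0 satisfy, for each t ∈ {1, …, T}: (i) f(θ_t) − f(ν) ≤ ⟪g_t, θ_t − ν⟫ + ε_t for all ν ∈ Θ (g_t is an ε_t-subgradient of f at θ_t on Θ); (ii) ‖g_t‖ ≤ G; (iii) θ_{t+1} is the Euclidean projection of θ_t − η_t g_t onto Θ, characterized by ⟪(θ_t − η_t g_t) − θ_{t+1}, ν − θ_{t+1}⟫ ≤ 0 for all ν ∈ Θ; and (iv) (1/2)‖θ − ν‖² ≤ R² for all θ, ν ∈ Θ. Then f((1/T)·Σ_{t=1}^T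 θ_t) − f(θ*) ≤ (R²/c + c·G²)/√T + (1/T)·Σ_{t=1}^T ε_t. -/
open RealInnerProductSpace Finset

theorem projected_approx_subgradient_convergence {E : Type*} [NormedAddCommGroup E]
    [InnerProductSpace ℝ E] (Θ : Set E) (hΘconv : Convex ℝ Θ) (hΘne : Θ.Nonempty)
    (f : E → ℝ) (hf : ConvexOn ℝ Θ f)
    (θstar : E) (hθstar : θstar ∈ Θ) (hmin : ∀ ν ∈ Θ, f θstar ≤ f ν)
    (T : ℕ) (hT : 1 ≤ T) (c : ℝ) (hc : 0 < c) (G : ℝ) (hG : 0 ≤ G)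
    (R : ℝ) (hR : 0 ≤ R)
    (θ : ℕ → E) (g : ℕ → E) (ε : ℕ → ℝ) (hεnn : ∀ t ∈ Icc 1 T, 0 ≤ ε t)
    (hθmem : ∀ t ∈ Icc 1 (T + 1), θ t ∈ Θ)
    (hsubgrad : ∀ t ∈ Icc 1 T, ∀ ν ∈ Θ, f (θ t) - f ν ≤ ⟪g t, θ t - ν⟫ + ε t)
    (hgbound : ∀ t ∈ Icc 1 T, ‖g t‖ ≤ G)
    (hproj : ∀ t ∈ Icc 1 T, ∀ ν ∈ Θ,
      ⟪(θ t - (c / Real.sqrt t) • g t) - θ (t + 1), ν - θ (t + 1)⟫ ≤ 0)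
    (hdiam : ∀ θ' ∈ Θ, ∀ ν ∈ Θ, (1 / 2) * ‖θ' - ν‖ ^ 2 ≤ R ^ 2) :
    f ((1 / (T : ℝ)) • ∑ t ∈ Icc 1 T, θ t) - f θstar ≤
      (R ^ 2 / c + c * G ^ 2) / Real.sqrt T + (1 / (T : ℝ)) * ∑ t ∈ Icc 1 T, ε t := by
  have step : ∀ t ∈ Icc 1 T, f (θ t) - f θstar ≤
      Real.sqrt t / c * ((1 / 2) * ‖θ t - θstar‖ ^ 2 - (1 / 2) * ‖θ (t + 1) - θstar‖ ^ 2)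
        + c * G ^ 2 / (2 * Real.sqrt t) + ε t := by
    intro t ht
    have h1 := hsubgrad t ht θstar hθstar
    have h2 := hgbound t ht
    have h3 := hproj t ht θstar hθstar
    have htpos : (0 : ℝ) < t := by
      have := (Finset.mem_Icc.mp ht).1
      exact_mod_cast this
    have hs : 0 < Real.sqrt t := Real.sqrt_pos.mpr htpos
    set s := Real.sqrt t with hsdef
    obtain ⟨η, hη⟩ : ∃ η, η = c / s := ⟨_, rfl⟩
    rw [← hη] at h3
    have hηpos : 0 < η := by rw [hη]; positivity
    obtain ⟨a, ha⟩ : ∃ a, a = θ t - θ (t + 1) := ⟨_, rfl⟩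
    obtain ⟨b, hb⟩ : ∃ b, b = θ (t + 1) - θstar := ⟨_, rfl⟩
    have e1 : θ t - θstar = a + b := by rw [ha, hb]; abel
    have e2 : θ t - η • g t - θ (t + 1) = a - η • g t := by rw [ha]; abel
    have e3 : θstar - θ (t + 1) = -b := by rw [hb]; abel
    rw [e2, e3, inner_neg_right, inner_sub_left, real_inner_smul_left] at h3
    rw [e1, inner_add_right] at h1
    rw [e1, ← hb, norm_add_sq_real]
    have h4 : 0 ≤ ‖a - η • g t‖ ^ 2 := by positivity
    rw [norm_sub_sq_real, real_inner_smul_right, norm_smul, Real.norm_eq_abs, mul_pow, sq_abs,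
      real_inner_comm] at h4
    have h5 : ‖g t‖ ^ 2 ≤ G ^ 2 := by gcongr
    have h6 : η ^ 2 * ‖g t‖ ^ 2 ≤ η ^ 2 * G ^ 2 := by gcongr
    have h7 : η * (⟪g t, a⟫ + ⟪g t, b⟫) ≤
        (1 / 2) * (‖a‖ ^ 2 + 2 * ⟪a, b⟫ + ‖b‖ ^ 2) - (1 / 2) * ‖b‖ ^ 2 + η ^ 2 * G ^ 2 / 2 := by
      linarith
    have h8 := mul_le_mul_of_nonneg_left h7 (inv_nonneg.mpr hηpos.le)
    rw [inv_mul_cancel_left₀ hηpos.ne'] at h8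
    have e4 : s / c = η⁻¹ := by rw [hη, inv_div]
    have e5 : c * G ^ 2 / (2 * s) = η⁻¹ * (η ^ 2 * G ^ 2 / 2) := by
      rw [hη]; field_simp
    rw [e4, e5]
    linarith
  have key : ∀ n : ℕ, n ≤ T → ∑ t ∈ Icc 1 n, (f (θ t) - f θstar) ≤
      Real.sqrt n / c * (R ^ 2 - (1 / 2) * ‖θ (n + 1) - θstar‖ ^ 2) + c * G ^ 2 * Real.sqrt n
        + ∑ t ∈ Icc 1 n, ε t := by
    intro n
    induction n with
    | zero => intro _; simp
    | succ n ih =>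
      intro hn
      rw [Finset.sum_Icc_succ_top (by omega), Finset.sum_Icc_succ_top (by omega)]
      have h1 := ih (by omega)
      have h2 := step (n + 1) (by simp; omega)
      have h3 := hdiam (θ (n + 1)) (hθmem _ (by simp; omega)) θstar hθstar
      have hs : 0 < Real.sqrt ((n + 1 : ℕ) : ℝ) := Real.sqrt_pos.mpr (by positivity)
      have hr : 0 ≤ Real.sqrt (n : ℝ) := Real.sqrt_nonneg _
      have hs2 : Real.sqrt ((n + 1 : ℕ) : ℝ) ^ 2 = n + 1 := by
        rw [Real.sq_sqrt (by positivity)]; push_cast; ring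
      have hr2 : Real.sqrt (n : ℝ) ^ 2 = n := Real.sq_sqrt (by positivity)
      have hrs : Real.sqrt (n : ℝ) ≤ Real.sqrt ((n + 1 : ℕ) : ℝ) :=
        Real.sqrt_le_sqrt (by push_cast; linarith)
      generalize Real.sqrt ((n + 1 : ℕ) : ℝ) = s at *
      generalize Real.sqrt (n : ℝ) = r at *
      have h4 : 1 / (2 * s) ≤ s - r := by
        rw [div_le_iff₀ (by positivity)]
        nlinarith [sq_nonneg (s - r)]
      have h5 : c * G ^ 2 / (2 * s) ≤ c * G ^ 2 * (s - r) := by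
        rw [← mul_one_div]
        gcongr
      have h6 : r / c ≤ s / c := by gcongr
      have h7 := mul_le_mul_of_nonneg_right h6 (sub_nonneg.mpr h3)
      linarith
  have hTpos : (0 : ℝ) < T := by exact_mod_cast hT
  have hs : 0 < Real.sqrt T := Real.sqrt_pos.mpr hTpos
  have hs2 : Real.sqrt T ^ 2 = T := Real.sq_sqrt hTpos.le
  have jensen : f ((1 / (T : ℝ)) • ∑ t ∈ Icc 1 T, θ t) ≤ (1 / (T : ℝ)) * ∑ t ∈ Icc 1 T, f (θ t) := by
    rw [Finset.smul_sum, Finset.mul_sum]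
    refine hf.map_sum_le (fun _ _ => by positivity) ?_ ?_
    · simp [hTpos.ne']
    · intro t ht
      exact hθmem t (by simp at ht ⊢; omega)
  have hk := key T le_rfl
  rw [Finset.sum_sub_distrib] at hk
  simp only [Finset.sum_const, Nat.card_Icc, Nat.add_sub_cancel, nsmul_eq_mul] at hk
  have h1 : Real.sqrt T / c * (R ^ 2 - (1 / 2) * ‖θ (T + 1) - θstar‖ ^ 2) ≤
      Real.sqrt T / c * R ^ 2 := by
    gcongr
    have : 0 ≤ ‖θ (T + 1) - θstar‖ ^ 2 := by positivity
    linarith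
  have h2 : (∑ t ∈ Icc 1 T, f (θ t)) - T * f θstar ≤
      Real.sqrt T / c * R ^ 2 + c * G ^ 2 * Real.sqrt T + ∑ t ∈ Icc 1 T, ε t := by linarith
  have h3 := mul_le_mul_of_nonneg_left h2 (one_div_nonneg.mpr hTpos.le)
  have e1 : 1 / (T : ℝ) * ((∑ t ∈ Icc 1 T, f (θ t)) - T * f θstar) =
      1 / (T : ℝ) * (∑ t ∈ Icc 1 T, f (θ t)) - f θstar := by
    field_simp
  have e2 : (R ^ 2 / c + c * G ^ 2) / Real.sqrt T =
      1 / (T : ℝ) * (Real.sqrt T / c * R ^ 2 + c * G ^ 2 * Real.sqrt T) := by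
    have : 1 / (T : ℝ) = 1 / Real.sqrt T ^ 2 := by rw [hs2]
    rw [this]
    field_simp
  rw [e2]
  rw [e1] at h3
  linarith
end

section
/- Let E be a real inner product space, Θ ⊆ E a nonempty convex set, and f : E → ℝ convex on Θ with a minimizer θ* ∈ Θ (f(θ*) ≤ f(ν) for all ν ∈ Θ). Let T ≥ 1, let α > 0, G ≥ 0, and for t = 1, …, T set η_t = 2/(α(t+1)). Let θ₁, …, θ_{T+1} ∈ Θ, g₁, …, g_T ∈ E, and ε₁, …, ε_T ≥ 0 satisfy, for each t ∈ {1, …, T}: (i) the strongly-convex ε_t-subgradient inequality f(θ_t) − f(θ*) ≤ ⟪g_t, θ_t − θ*⟫ + ε_t − (α/2)‖θ* − θ_t‖²; (ii) ‖g_t‖ ≤ G; and (iii) θ_{t+1} is the Euclidean projection of θ_t − η_t g_t onto Θ, characterized by ⟪(θ_t − η_t g_t) − θ_{t+1}, ν − θ_{t+1}⟫ ≤ 0 for all ν ∈ Θ. Then f((2/(T(T+1)))·Σ_{t=1}^T t·θ_t) − f(θ*) ≤ 2G²/(α(T+1)) + (2/(T(T+1)))·Σ_{t=1}^T t·ε_t.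 -/
open RealInnerProductSpace Finset

theorem projected_approx_subgradient_convergence_strongly_convex {E : Type*}
    [NormedAddCommGroup E] [InnerProductSpace ℝ E]
    (Θ : Set E) (hΘconv : Convex ℝ Θ) (hΘne : Θ.Nonempty)
    (f : E → ℝ) (hf : ConvexOn ℝ Θ f)
    (θstar : E) (hθstar : θstar ∈ Θ) (hmin : ∀ ν ∈ Θ, f θstar ≤ f ν)
    (T : ℕ) (hT : 1 ≤ T) (α : ℝ) (hα : 0 < α) (G : ℝ) (hG : 0 ≤ G)
    (θ : ℕ → E) (g : ℕ → E) (ε : ℕ → ℝ) (hεnn : ∀ t ∈ Icc 1 T, 0 ≤ ε t)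
    (hθmem : ∀ t ∈ Icc 1 (T + 1), θ t ∈ Θ)
    (hsubgrad : ∀ t ∈ Icc 1 T,
      f (θ t) - f θstar ≤ ⟪g t, θ t - θstar⟫ + ε t - (α / 2) * ‖θstar - θ t‖ ^ 2)
    (hgbound : ∀ t ∈ Icc 1 T, ‖g t‖ ≤ G)
    (hproj : ∀ t ∈ Icc 1 T, ∀ ν ∈ Θ,
      ⟪(θ t - (2 / (α * ((t : ℝ) + 1))) • g t) - θ (t + 1), ν - θ (t + 1)⟫ ≤ 0) :
    f ((2 / ((T : ℝ) * ((T : ℝ) + 1))) • ∑ t ∈ Icc 1 T, (t : ℝ) • θ t) - f θstar ≤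
      2 * G ^ 2 / (α * ((T : ℝ) + 1)) +
        (2 / ((T : ℝ) * ((T : ℝ) + 1))) * ∑ t ∈ Icc 1 T, (t : ℝ) * ε t := by
  have step : ∀ t ∈ Icc 1 T, (t : ℝ) * (f (θ t) - f θstar) ≤ (t : ℝ) * ε t + G ^ 2 / α
      + α / 4 * ((t : ℝ) * ((t : ℝ) - 1)) * ‖θ t - θstar‖ ^ 2
      - α / 4 * ((t : ℝ) * ((t : ℝ) + 1)) * ‖θ (t + 1) - θstar‖ ^ 2 := by
    intro t ht
    have h1 := hsubgrad t ht
    have h2 := hgbound t ht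
    have h3 := hproj t ht θstar hθstar
    have ht0 : (0 : ℝ) ≤ t := Nat.cast_nonneg t
    have hd : 0 < α * ((t : ℝ) + 1) := by positivity
    obtain ⟨η, hη⟩ : ∃ η, η = 2 / (α * ((t : ℝ) + 1)) := ⟨_, rfl⟩
    rw [← hη] at h3
    have hηe : η * (α * ((t : ℝ) + 1)) = 2 := by rw [hη]; field_simp
    have hηpos : 0 < η := by rw [hη]; positivity
    rw [norm_sub_rev] at h1
    obtain ⟨a, ha⟩ : ∃ a, a = θ t - θstar := ⟨_, rfl⟩
    obtain ⟨p, hp⟩ : ∃ p, p = θ (t + 1) - θstar := ⟨_, rfl⟩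
    have e1 : θ t - η • g t - θ (t + 1) = (a - η • g t) - p := by rw [ha, hp]; abel
    have e2 : θstar - θ (t + 1) = -p := by rw [hp]; abel
    rw [e1, e2, inner_neg_right, inner_sub_left, real_inner_self_eq_norm_sq] at h3
    rw [← ha] at h1
    rw [← ha, ← hp]
    have h4 : ‖(a - η • g t) - p‖ ^ 2 = ‖a - η • g t‖ ^ 2 - 2 * ⟪a - η • g t, p⟫ + ‖p‖ ^ 2 :=
      norm_sub_sq_real _ _
    have h5 : ‖a - η • g t‖ ^ 2 = ‖a‖ ^ 2 - 2 * (η * ⟪g t, a⟫) + η ^ 2 * ‖g t‖ ^ 2 := by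
      rw [norm_sub_sq_real, real_inner_smul_right, norm_smul, real_inner_comm, mul_pow,
        Real.norm_eq_abs, sq_abs]
    have h6 : ‖g t‖ ^ 2 ≤ G ^ 2 := by gcongr
    have h7 : 2 * (η * ⟪g t, a⟫) ≤ ‖a‖ ^ 2 - ‖p‖ ^ 2 + η ^ 2 * G ^ 2 := by
      have := sq_nonneg ‖(a - η • g t) - p‖
      have := mul_le_mul_of_nonneg_left h6 (sq_nonneg η)
      linarith
    have h8 : 4 * ⟪g t, a⟫ ≤ α * ((t : ℝ) + 1) * (‖a‖ ^ 2 - ‖p‖ ^ 2) + 2 * η * G ^ 2 := by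
      have h := mul_le_mul_of_nonneg_left h7 hd.le
      have r1 : α * ((t : ℝ) + 1) * (2 * (η * ⟪g t, a⟫)) = 4 * ⟪g t, a⟫ := by
        linear_combination (2 * ⟪g t, a⟫) * hηe
      have r2 : α * ((t : ℝ) + 1) * (η ^ 2 * G ^ 2) = 2 * η * G ^ 2 := by
        linear_combination (η * G ^ 2) * hηe
      linarith
    have h9 : (t : ℝ) * η * G ^ 2 ≤ 2 * (G ^ 2 / α) := by
      have : (t : ℝ) * η ≤ 2 / α := by
        rw [le_div_iff₀ hα]
        nlinarith [mul_pos hηpos hα]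
      calc _ ≤ 2 / α * G ^ 2 := by gcongr
        _ = _ := by ring
    have h10 := mul_le_mul_of_nonneg_left h1 ht0
    have h11 := mul_le_mul_of_nonneg_left h8 ht0
    linarith
  have key : ∀ n ≤ T, ∑ t ∈ Icc 1 n, (t : ℝ) * (f (θ t) - f θstar) ≤
      ∑ t ∈ Icc 1 n, (t : ℝ) * ε t + n * (G ^ 2 / α)
        - α / 4 * ((n : ℝ) * ((n : ℝ) + 1)) * ‖θ (n + 1) - θstar‖ ^ 2 := by
    intro n
    induction n with
    | zero => intro _; simp
    | succ n ih =>
      intro hn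
      have h1 := ih (by omega)
      have h2 := step (n + 1) (by simp; omega)
      rw [Finset.sum_Icc_succ_top (by omega), Finset.sum_Icc_succ_top (by omega)]
      push_cast at h2 ⊢
      linarith
  have hsum : ∀ n : ℕ, ∑ t ∈ Icc 1 n, (t : ℝ) = (n : ℝ) * ((n : ℝ) + 1) / 2 := by
    intro n
    induction n with
    | zero => simp
    | succ n ih =>
      rw [Finset.sum_Icc_succ_top (by omega), ih]
      push_cast
      ring
  have hTpos : (0 : ℝ) < T := by exact_mod_cast hT
  obtain ⟨c, hc⟩ : ∃ c, c = 2 / ((T : ℝ) * ((T : ℝ) + 1)) := ⟨_, rfl⟩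
  have hcpos : 0 < c := by rw [hc]; positivity
  have hw : ∑ t ∈ Icc 1 T, c * (t : ℝ) = 1 := by
    rw [← Finset.mul_sum, hsum, hc]
    field_simp
  have hJ := hf.map_sum_le (t := Icc 1 T) (w := fun t => c * (t : ℝ)) (p := θ)
    (fun t _ => by positivity) hw
    (fun t ht => hθmem t (by simp only [Finset.mem_Icc] at ht ⊢; omega))
  have e3 : c • ∑ t ∈ Icc 1 T, (t : ℝ) • θ t = ∑ t ∈ Icc 1 T, (c * (t : ℝ)) • θ t := by
    rw [Finset.smul_sum]
    simp only [smul_smul]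
  have e4 : ∑ t ∈ Icc 1 T, (c * (t : ℝ)) • f (θ t) - f θstar
      = c * ∑ t ∈ Icc 1 T, (t : ℝ) * (f (θ t) - f θstar) := by
    have : f θstar = ∑ t ∈ Icc 1 T, c * (t : ℝ) * f θstar := by
      rw [← Finset.sum_mul, hw, one_mul]
    conv_lhs => rw [this]
    rw [← Finset.sum_sub_distrib, Finset.mul_sum]
    refine Finset.sum_congr rfl fun t _ => ?_
    rw [smul_eq_mul]
    ring
  have e5 : 2 * G ^ 2 / (α * ((T : ℝ) + 1)) = c * (T * (G ^ 2 / α)) := by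
    rw [hc]
    field_simp
  rw [e5, ← hc, e3]
  have h1 := key T le_rfl
  have h2 : 0 ≤ α / 4 * ((T : ℝ) * ((T : ℝ) + 1)) * ‖θ (T + 1) - θstar‖ ^ 2 := by positivity
  have h3 : ∑ t ∈ Icc 1 T, (t : ℝ) * (f (θ t) - f θstar) ≤
      ∑ t ∈ Icc 1 T, (t : ℝ) * ε t + T * (G ^ 2 / α) := by linarith
  have h4 := mul_le_mul_of_nonneg_left h3 hcpos.le
  rw [← e4] at h4
  linarith
end
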